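/- Let λ₁, λ₂, λ₃ be pairwise distinct nonzero complex numbers, f(x) = (x−λ₁)(x−λ₂)(x−λ₃), and fix λ ∈ ℂ with λ² = −λ₁λ₂λ₃. Consider the 𝔸¹-chain equivalence relation on X₁(ℂ), namely the equivalence relation generated by: v ∼ w if there exist polynomials a, b, c ∈ ℂ[t] with c² = a²·f(b), with a, b, c having no common zero in ℂ, and with (a(0), b(0), c(0)) = v and (a(1), b(1), c(1)) = w. Then the equivalence class of α₁ = (1, 0, λ) is the singleton {α₁}; in particular, α₁ = (1,0,λ) and β₁ = (0,1,0) are not 𝔸¹-chain equivalent in X₁(ℂ). -/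

import Mathlib

open Polynomial

/-- `f` applied to a complex number. -/
noncomputable def fC (l1 l2 l3 z : ℂ) : ℂ := (z - l1) * (z - l2) * (z - l3)

/-- `f` applied to a polynomial. -/
noncomputable def fP (l1 l2 l3 : ℂ) (p : Polynomial ℂ) : Polynomial ℂ :=
  (p - C l1) * (p - C l2) * (p - C l3)

/-- The set `X₁(ℂ)` of triples `(p,q,r) ∈ ℂ³` with `r² = p²·f(q)` and `(p,q,r) ≠ (0,0,0)`. -/
def X1Set (l1 l2 l3 : ℂ) : Set (ℂ × ℂ × ℂ) :=
  {v | v.2.2 ^ 2 = v.1 ^ 2 * fC l1 l2 l3 v.2.1 ∧ v ≠ (0, 0, 0)}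

/-- Elementary 𝔸¹-homotopy relation on `X₁(ℂ)`: `v ∼ w` if there are polynomials
`a, b, c ∈ ℂ[t]` with `c² = a²·f(b)`, with no common zero, connecting `v` (at `t = 0`)
to `w` (at `t = 1`). -/
def chainRel1 (l1 l2 l3 : ℂ) (v w : X1Set l1 l2 l3) : Prop :=
  ∃ a b c : Polynomial ℂ,
    c ^ 2 = a ^ 2 * fP l1 l2 l3 b ∧
    (∀ t : ℂ, ¬ (a.eval t = 0 ∧ b.eval t = 0 ∧ c.eval t = 0)) ∧
    (a.eval 0, b.eval 0, c.eval 0) = v.val ∧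
    (a.eval 1, b.eval 1, c.eval 1) = w.val

/-- If the product of two coprime polynomials over `ℂ` is a square, the first factor is a square. -/
lemma exists_eq_sq_of_isCoprime_of_mul_eq_sq {p q d : ℂ[X]} (hpq : IsCoprime p q)
    (h : p * q = d ^ 2) : ∃ u : ℂ[X], p = u ^ 2 := by
  obtain ⟨e, he⟩ := exists_associated_pow_of_mul_eq_pow' hpq h
  obtain ⟨k, hk⟩ := he
  obtain ⟨z, -, hz⟩ := Polynomial.isUnit_iff.1 k.isUnit
  obtain ⟨s, hs⟩ := IsAlgClosed.exists_pow_nat_eq z (n := 2) (by norm_num)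
  refine ⟨e * C s, ?_⟩
  rw [← hk, ← hz, ← hs, C_pow, mul_pow]

lemma isCoprime_sub_C {l m : ℂ} (h : l ≠ m) (b : ℂ[X]) : IsCoprime (b - C l) (b - C m) := by
  have hu : C (m - l)⁻¹ * C (m - l) = (1 : ℂ[X]) := by
    rw [← C_mul, inv_mul_cancel₀ (sub_ne_zero.2 h.symm), C_1]
  refine ⟨C (m - l)⁻¹, -C (m - l)⁻¹, ?_⟩
  rw [← hu, C_sub]
  ring

/-- Polynomial maps from the affine line to `y² = (x - l₁)(x - l₂)(x - l₃)` have constant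
first coordinate. -/
lemma exists_eq_C_of_sq_eq_fP {l1 l2 l3 : ℂ} (h12 : l1 ≠ l2) (h13 : l1 ≠ l3) (h23 : l2 ≠ l3)
    {b d : ℂ[X]} (h : d ^ 2 = fP l1 l2 l3 b) : ∃ z : ℂ, b = C z := by
  unfold fP at h
  obtain ⟨u, hu⟩ := exists_eq_sq_of_isCoprime_of_mul_eq_sq (d := d)
    ((isCoprime_sub_C h12 b).mul_right (isCoprime_sub_C h13 b)) (by rw [h]; ring)
  obtain ⟨v, hv⟩ := exists_eq_sq_of_isCoprime_of_mul_eq_sq (d := d)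
    ((isCoprime_sub_C h12.symm b).mul_right (isCoprime_sub_C h23 b)) (by rw [h]; ring)
  have huv : (u - v) * (u + v) = C (l2 - l1) := by
    rw [C_sub]
    linear_combination hv - hu
  have hunit : IsUnit ((u - v) * (u + v)) := by
    rw [huv]
    exact Polynomial.isUnit_C.2 (sub_ne_zero.2 h12.symm).isUnit
  obtain ⟨x, -, hx⟩ := Polynomial.isUnit_iff.1 (isUnit_of_mul_isUnit_left hunit)
  obtain ⟨y, -, hy⟩ := Polynomial.isUnit_iff.1 (isUnit_of_mul_isUnit_right hunit)
  have hu' : u = C ((x + y) / 2) := by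
    have h2 : C (2⁻¹ : ℂ) * 2 = (1 : ℂ[X]) := by
      rw [← C_ofNat, ← C_mul, inv_mul_cancel₀ two_ne_zero, C_1]
    rw [div_eq_inv_mul, C_mul, C_add, hx, hy]
    linear_combination (-u) * h2
  refine ⟨((x + y) / 2) ^ 2 + l1, ?_⟩
  rw [C_add, C_pow, ← hu', ← hu]
  ring

/-- A chain whose second coordinate vanishes somewhere where the first does not is constant. -/
lemma eval_eq_eval_of_eval_eq_zero {l1 l2 l3 : ℂ} (h12 : l1 ≠ l2) (h13 : l1 ≠ l3)
    (h23 : l2 ≠ l3) {a b c : ℂ[X]} (h : c ^ 2 = a ^ 2 * fP l1 l2 l3 b)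
    (hz : ∀ t : ℂ, ¬ (a.eval t = 0 ∧ b.eval t = 0 ∧ c.eval t = 0)) {s : ℂ}
    (ha : a.eval s ≠ 0) (hb : b.eval s = 0) (t : ℂ) :
    (a.eval t, b.eval t, c.eval t) = (a.eval s, b.eval s, c.eval s) := by
  have ha0 : a ≠ 0 := by
    rintro rfl
    simp at ha
  obtain ⟨d, rfl⟩ : a ∣ c := (IsIntegrallyClosed.pow_dvd_pow_iff two_ne_zero).1 (Dvd.intro _ h.symm)
  have hd : d ^ 2 = fP l1 l2 l3 b := by
    rw [mul_pow] at h
    exact mul_left_cancel₀ (pow_ne_zero 2 ha0) h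
  obtain ⟨z, rfl⟩ := exists_eq_C_of_sq_eq_fP h12 h13 h23 hd
  obtain rfl : z = 0 := by simpa using hb
  have hda : d.natDegree = 0 := by
    have hdeg := congrArg natDegree hd
    rw [natDegree_pow, fP, ← C_sub, ← C_sub, ← C_sub, ← C_mul, ← C_mul, natDegree_C] at hdeg
    omega
  have haa : a.degree = 0 := by
    by_contra hne
    obtain ⟨r, hr⟩ := IsAlgClosed.exists_root a hne
    exact hz r ⟨hr, by simp, by simp [hr.eq_zero]⟩
  rw [eq_C_of_natDegree_eq_zero hda, eq_C_of_degree_eq_zero haa]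
  simp

/-- For pairwise distinct nonzero `λ₁, λ₂, λ₃` and `λ` with
`λ² = −λ₁λ₂λ₃`, the 𝔸¹-chain equivalence class of `α₁ = (1,0,λ)` in `X₁(ℂ)` is the
singleton `{α₁}`; in particular `α₁` and `β₁ = (0,1,0)` are not 𝔸¹-chain equivalent. -/
theorem alpha1_class_singleton
    (l1 l2 l3 : ℂ) (h1 : l1 ≠ 0) (h2 : l2 ≠ 0) (h3 : l3 ≠ 0)
    (h12 : l1 ≠ l2) (h13 : l1 ≠ l3) (h23 : l2 ≠ l3)
    (lam : ℂ) (hlam : lam ^ 2 = -(l1 * l2 * l3))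
    (α β : X1Set l1 l2 l3) (hα : α.val = (1, 0, lam)) (hβ : β.val = (0, 1, 0)) :
    (∀ v : X1Set l1 l2 l3, Relation.EqvGen (chainRel1 l1 l2 l3) α v ↔ v = α) ∧
    ¬ Relation.EqvGen (chainRel1 l1 l2 l3) α β := by
  have hstep : ∀ v w : X1Set l1 l2 l3, chainRel1 l1 l2 l3 v w → (v = α ↔ w = α) := by
    rintro v w ⟨a, b, c, h, hz, hv, hw⟩
    constructor
    · rintro rfl
      have he := hv.trans hα
      simp only [Prod.mk.injEq] at he
      apply Subtype.ext
      rw [← hw, ← hv]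
      exact eval_eq_eval_of_eval_eq_zero h12 h13 h23 h hz (by simp [he.1]) he.2.1 1
    · rintro rfl
      have he := hw.trans hα
      simp only [Prod.mk.injEq] at he
      apply Subtype.ext
      rw [← hw, ← hv]
      exact eval_eq_eval_of_eval_eq_zero h12 h13 h23 h hz (by simp [he.1]) he.2.1 0
  have hgen : ∀ v w : X1Set l1 l2 l3,
      Relation.EqvGen (chainRel1 l1 l2 l3) v w → (v = α ↔ w = α) := by
    intro v w h
    induction h with
    | rel v w h => exact hstep v w h
    | refl v => exact Iff.rfl
    | symm v w _ ih => exact ih.symm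
    | trans u v w _ _ ih ih' => exact ih.trans ih'
  refine ⟨fun v => ⟨fun h => (hgen α v h).1 rfl, ?_⟩, fun h => ?_⟩
  · rintro rfl
    exact Relation.EqvGen.refl _
  · have hβα := congrArg Subtype.val ((hgen α β h).1 rfl)
    rw [hα, hβ] at hβα
    simp at hβα
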